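/- Let 0 < r < R < 1. The pair (A(r,R), Δ) is quasi-split: the image of the restriction O(Δ) → O(A(r,R)) is neither dense nor closed, and there is a closed subspace Q_r of O(A(r,R)) such that O(A(r,R)) is the topological direct sum of the closure of O(Δ)|_{A(r,R)} and Q_r. -/

import Mathlib

open Set

/-- The holomorphic functions on an open set `U`, viewed as a subset of `C(U, ℂ)`
(which carries the compact-open topology). -/
def Hol {E : Type*} [NormedAddCommGroup E] [NormedSpace ℂ E] (U : Set E) :
    Set C(U, ℂ) :=
  {f | ∃ F : E → ℂ, DifferentiableOn ℂ F U ∧ ∀ z : U, f z = F z}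

open Metric Filter Topology

namespace QS

/-- The annulus. -/
abbrev Ann (r R : ℝ) : Set ℂ := {z | r < ‖z‖ ∧ ‖z‖ < R}

lemma isOpen_Ann (r R : ℝ) : IsOpen (Ann r R) :=
  (isOpen_lt continuous_const continuous_norm).inter (isOpen_lt continuous_norm continuous_const)

open Classical in
/-- Extension by zero. -/
noncomputable def ex {r R : ℝ} (f : C(Ann r R, ℂ)) (z : ℂ) : ℂ :=
  if h : z ∈ Ann r R then f ⟨z, h⟩ else 0

lemma ex_of_mem {r R : ℝ} (f : C(Ann r R, ℂ)) {z : ℂ} (h : z ∈ Ann r R) : ex f z = f ⟨z, h⟩ := by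
  simp [ex, h]

lemma ex_coe {r R : ℝ} (f : C(Ann r R, ℂ)) (z : Ann r R) : ex f z = f z := ex_of_mem f z.2

lemma ex_continuousOn {r R : ℝ} (f : C(Ann r R, ℂ)) : ContinuousOn (ex f) (Ann r R) := by
  rw [continuousOn_iff_continuous_restrict]
  convert f.continuous using 1
  ext z
  exact ex_coe f z

lemma ex_diff {r R : ℝ} {f : C(Ann r R, ℂ)} (hf : f ∈ Hol (Ann r R)) :
    DifferentiableOn ℂ (ex f) (Ann r R) := by
  obtain ⟨F, hF, h⟩ := hf
  exact hF.congr fun z hz => by rw [ex_of_mem f hz, h]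

lemma hol_of_diff {r R : ℝ} {f : C(Ann r R, ℂ)} (h : DifferentiableOn ℂ (ex f) (Ann r R)) :
    f ∈ Hol (Ann r R) := ⟨ex f, h, fun z => (ex_coe f z).symm⟩

/-- Laurent coefficient computed on the circle of radius `s`. -/
noncomputable def cf (s : ℝ) (F : ℂ → ℂ) (n : ℕ) : ℂ :=
  (2 * Real.pi * Complex.I : ℂ)⁻¹ • ∮ z in C(0, s), (z⁻¹) ^ n * z⁻¹ * F z

lemma sphere_sub {r R s : ℝ} (h1 : r < s) (h2 : s < R) : sphere (0:ℂ) s ⊆ Ann r R := by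
  intro z hz
  rw [mem_sphere_zero_iff_norm] at hz
  exact ⟨hz ▸ h1, hz ▸ h2⟩

lemma cf_congr {s : ℝ} (hs : 0 ≤ s) {F G : ℂ → ℂ} (n : ℕ)
    (h : ∀ z ∈ sphere (0:ℂ) s, F z = G z) : cf s F n = cf s G n := by
  unfold cf
  congr 1
  apply circleIntegral.integral_congr hs
  intro z hz
  simp only [h z hz]

lemma cf_integrable {s : ℝ} (hs : 0 < s) {F : ℂ → ℂ} (n : ℕ)
    (hF : ContinuousOn F (sphere (0:ℂ) s)) :
    CircleIntegrable (fun z => (z⁻¹) ^ n * z⁻¹ * F z) 0 s := by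
  apply ContinuousOn.circleIntegrable hs.le
  have h0 : ContinuousOn (fun z : ℂ => z⁻¹) (sphere (0:ℂ) s) := by
    apply continuousOn_inv₀.mono
    intro z hz h
    simp only [mem_sphere_zero_iff_norm] at hz
    rw [h, norm_zero] at hz
    exact hs.ne hz
  exact ((h0.pow n).mul h0).mul hF

lemma cf_add {s : ℝ} (hs : 0 < s) {F G : ℂ → ℂ} (n : ℕ)
    (hF : ContinuousOn F (sphere (0:ℂ) s)) (hG : ContinuousOn G (sphere (0:ℂ) s)) :
    cf s (fun z => F z + G z) n = cf s F n + cf s G n := by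
  unfold cf
  rw [← smul_add, ← circleIntegral.integral_add (cf_integrable hs n hF) (cf_integrable hs n hG)]
  simp only [mul_add]

lemma cf_smul {s : ℝ} (c : ℂ) {F : ℂ → ℂ} (n : ℕ) :
    cf s (fun z => c * F z) n = c * cf s F n := by
  unfold cf
  rw [smul_eq_mul, smul_eq_mul, mul_left_comm, ← smul_eq_mul c, ← circleIntegral.integral_smul]
  congr 2
  ext z
  simp only [smul_eq_mul]
  ring

lemma cf_bound {s M : ℝ} (hs : 0 < s) {F : ℂ → ℂ} (n : ℕ)
    (hF : ∀ z ∈ sphere (0:ℂ) s, ‖F z‖ ≤ M) : ‖cf s F n‖ ≤ M * (s⁻¹) ^ n := by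
  have := circleIntegral.norm_two_pi_i_inv_smul_integral_le_of_norm_le_const (c := 0) (R := s)
    (f := fun z => (z⁻¹) ^ n * z⁻¹ * F z) (C := (s⁻¹) ^ n * s⁻¹ * M) hs.le (by
      intro z hz
      have h2 := hF z hz
      rw [mem_sphere_zero_iff_norm] at hz
      rw [norm_mul, norm_mul, norm_pow, norm_inv, hz]
      gcongr)
  refine this.trans (le_of_eq ?_)
  field_simp

lemma cf_indep {r R s t : ℝ} (hr : 0 < r) (hs : r < s) (hst : s ≤ t) (ht : t < R) {F : ℂ → ℂ}
    (hF : DifferentiableOn ℂ F (Ann r R)) (n : ℕ) : cf t F n = cf s F n := by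
  unfold cf
  congr 1
  have hd : DifferentiableOn ℂ (fun z => (z⁻¹) ^ n * z⁻¹ * F z) (Ann r R) := by
    have h0 : DifferentiableOn ℂ (fun z : ℂ => z⁻¹) (Ann r R) := by
      apply differentiableOn_inv.mono
      intro z hz h
      have := hz.1
      rw [h, norm_zero] at this
      linarith
    exact ((h0.pow n).mul h0).mul hF
  apply Complex.circleIntegral_eq_of_differentiable_on_annulus_off_countable (hr.trans hs) hst
    countable_empty
  · apply hd.continuousOn.mono
    rintro z ⟨h1, h2⟩
    simp only [mem_closedBall_zero_iff, mem_ball_zero_iff, not_lt] at h1 h2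
    exact ⟨by linarith, by linarith⟩
  · rintro z ⟨⟨h1, h2⟩, -⟩
    simp only [mem_closedBall_zero_iff, mem_ball_zero_iff, not_le] at h1 h2
    exact hd.differentiableAt ((isOpen_Ann r R).mem_nhds ⟨by linarith, by linarith⟩)

lemma cf_indep' {r R s t : ℝ} (hr : 0 < r) (hs : r < s) (hs' : s < R) (ht' : r < t) (ht : t < R)
    {F : ℂ → ℂ} (hF : DifferentiableOn ℂ F (Ann r R)) (n : ℕ) : cf t F n = cf s F n := by
  rcases le_total s t with h | h
  · exact cf_indep hr hs h ht hF n
  · exact (cf_indep hr ht' h hs' hF n).symm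

lemma cf_zpow {s : ℝ} (hs : 0 < s) (k : ℤ) (n : ℕ) :
    cf s (fun z => z ^ k) n = if k = n then 1 else 0 := by
  have h : (∮ z in C(0, s), (z⁻¹) ^ n * z⁻¹ * z ^ k) = ∮ z in C(0, s), (z - 0) ^ (k - n - 1) := by
    apply circleIntegral.integral_congr hs.le
    intro z hz
    rw [mem_sphere_zero_iff_norm] at hz
    have hz0 : z ≠ 0 := by
      rintro rfl
      rw [norm_zero] at hz
      exact hs.ne hz
    simp only [sub_zero]
    rw [zpow_sub₀ hz0, zpow_sub₀ hz0, zpow_natCast, zpow_one, inv_pow]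
    field_simp
  unfold cf
  rw [h]
  split_ifs with hk
  · subst hk
    have := circleIntegral.integral_sub_center_inv (0:ℂ) hs.ne'
    simp only [sub_self, zero_sub, zpow_neg, zpow_one]
    rw [this, smul_eq_mul, inv_mul_cancel₀ Complex.two_pi_I_ne_zero]
  · rw [circleIntegral.integral_sub_zpow_of_ne (by omega), smul_zero]

/-- Uniform closeness on compacts. -/
lemma ev_close {r R s : ℝ} (h1 : r < s) (h2 : s < R) (f : C(Ann r R, ℂ)) {ε : ℝ} (hε : 0 < ε) :
    ∀ᶠ g in 𝓝 f, ∀ z ∈ sphere (0:ℂ) s, ‖ex g z - ex f z‖ ≤ ε := by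
  have h := ContinuousMap.tendsto_iff_forall_isCompact_tendstoUniformlyOn.1
    (tendsto_id (α := C(Ann r R, ℂ)) (x := 𝓝 f)) (Subtype.val ⁻¹' (sphere (0:ℂ) s))
    (IsInducing.subtypeVal.isCompact_preimage' (isCompact_sphere _ _)
      (by rw [Subtype.range_coe]; exact sphere_sub h1 h2))
  rw [Metric.tendstoUniformlyOn_iff] at h
  filter_upwards [h ε hε] with g hg z hz
  have := hg ⟨z, sphere_sub h1 h2 hz⟩ hz
  rw [ex_of_mem g (sphere_sub h1 h2 hz), ex_of_mem f (sphere_sub h1 h2 hz), ← dist_eq_norm,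
    dist_comm]
  exact this.le

lemma compact_bound {r R : ℝ} (hrR : r < R) {K : Set (Ann r R)} (hK : IsCompact K) :
    ∃ s, r < s ∧ s < R ∧ ∀ z ∈ K, ‖(z:ℂ)‖ ≤ s := by
  rcases K.eq_empty_or_nonempty with rfl | hne
  · exact ⟨(r + R) / 2, by linarith, by linarith, by simp⟩
  · obtain ⟨w, hw, hm⟩ := hK.exists_isMaxOn hne
      (f := fun z : Ann r R => ‖(z:ℂ)‖) (by fun_prop)
    exact ⟨‖(w:ℂ)‖, w.2.1, w.2.2, fun z hz => hm hz⟩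

/-- Partial sums. -/
noncomputable def S (r R : ℝ) (a : ℕ → ℂ) (N : ℕ) : C(Ann r R, ℂ) :=
  ⟨fun z => ∑ n ∈ Finset.range N, a n * (z:ℂ) ^ n, by fun_prop⟩

open Classical in
/-- The sum of the series. -/
noncomputable def T (r R : ℝ) (a : ℕ → ℂ) : C(Ann r R, ℂ) :=
  if h : Continuous (fun z : Ann r R => ∑' n, a n * (z:ℂ) ^ n) then ⟨_, h⟩ else 0

/-- Growth condition. -/
def Gr (r R : ℝ) (a : ℕ → ℂ) : Prop :=
  ∀ s, r < s → s < R → ∃ M, ∀ n, ‖a n‖ ≤ M * (s⁻¹) ^ n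

lemma term_bound {a : ℂ} {M s t : ℝ} {n : ℕ} {z : ℂ} (hs : 0 < s) (hz : ‖z‖ ≤ t)
    (ha : ‖a‖ ≤ M * (s⁻¹) ^ n) : ‖a * z ^ n‖ ≤ M * (t / s) ^ n := by
  have : 0 ≤ M * (s⁻¹) ^ n := (norm_nonneg _).trans ha
  calc ‖a * z ^ n‖ = ‖a‖ * ‖z‖ ^ n := by rw [norm_mul, norm_pow]
    _ ≤ (M * (s⁻¹) ^ n) * t ^ n := by gcongr
    _ = _ := by rw [div_eq_inv_mul, mul_pow]; ring

lemma summ {s t : ℝ} (M : ℝ) (ht : 0 < t) (hts : t < s) : Summable fun n : ℕ => M * (t / s) ^ n := by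
  have hs : 0 < s := ht.trans hts
  exact (summable_geometric_of_lt_one (by positivity) ((div_lt_one hs).2 hts)).mul_left M

lemma unif {r R : ℝ} (hr : 0 < r) (hrR : r < R) {a : ℕ → ℂ} (ha : Gr r R a) {K : Set (Ann r R)}
    (hK : IsCompact K) :
    TendstoUniformlyOn (fun N (z : Ann r R) => ∑ n ∈ Finset.range N, a n * (z:ℂ) ^ n)
      (fun z : Ann r R => ∑' n, a n * (z:ℂ) ^ n) atTop K := by
  obtain ⟨t, h1, h2, h3⟩ := compact_bound hrR hK
  obtain ⟨s, hs1, hs2⟩ := exists_between h2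
  obtain ⟨M, hM⟩ := ha s (h1.trans hs1) hs2
  exact tendstoUniformlyOn_tsum_nat (summ M (hr.trans h1) hs1)
    (fun n z hz => term_bound (by linarith) (h3 z hz) (hM n))

lemma T_apply {r R : ℝ} (hr : 0 < r) (hrR : r < R) {a : ℕ → ℂ} (ha : Gr r R a) (z : Ann r R) :
    T r R a z = ∑' n, a n * (z:ℂ) ^ n := by
  have : LocallyCompactSpace (Ann r R) := (isOpen_Ann r R).locallyCompactSpace
  have hc : Continuous (fun z : Ann r R => ∑' n, a n * (z:ℂ) ^ n) := by
    refine TendstoLocallyUniformly.continuous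
      (tendstoLocallyUniformly_iff_forall_isCompact.2 fun K hK => unif hr hrR ha hK)
      (Frequently.of_forall fun N => (S r R a N).continuous)
  simp [T, hc]

lemma T_tendsto {r R : ℝ} (hr : 0 < r) (hrR : r < R) {a : ℕ → ℂ} (ha : Gr r R a) :
    Tendsto (S r R a) atTop (𝓝 (T r R a)) := by
  rw [ContinuousMap.tendsto_iff_forall_isCompact_tendstoUniformlyOn]
  intro K hK
  have := unif hr hrR ha hK
  exact this.congr_right fun z hz => (T_apply hr hrR ha z).symm

lemma gr_hol {r R t : ℝ} (hr : 0 < r) (ht : r < t) (htR : t < R) {f : C(Ann r R, ℂ)}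
    (hf : f ∈ Hol (Ann r R)) : Gr r R (cf t (ex f)) := by
  intro s h1 h2
  obtain ⟨M, hM⟩ := (isCompact_sphere (0:ℂ) s).exists_bound_of_continuousOn
    ((ex_continuousOn f).mono (sphere_sub h1 h2))
  refine ⟨M, fun n => ?_⟩
  rw [cf_indep' hr h1 h2 ht htR (ex_diff hf)]
  exact cf_bound (hr.trans h1) n hM

lemma cf_sub {r R t : ℝ} (hr : 0 < r) (ht : r < t) (htR : t < R) (f g : C(Ann r R, ℂ)) (n : ℕ) :
    cf t (fun z => ex g z - ex f z) n = cf t (ex g) n - cf t (ex f) n := by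
  have hf := (ex_continuousOn f).mono (sphere_sub ht htR)
  have hg := (ex_continuousOn g).mono (sphere_sub ht htR)
  have := cf_add (hr.trans ht) n (hg.sub hf) hf
  simp only [Pi.sub_apply, sub_add_cancel] at this
  rw [eq_sub_iff_add_eq, ← this.symm]
  rfl

lemma cf_continuous {r R t : ℝ} (hr : 0 < r) (ht : r < t) (htR : t < R) (n : ℕ) :
    Continuous fun f : C(Ann r R, ℂ) => cf t (ex f) n := by
  have h0 : 0 < t := hr.trans ht
  rw [continuous_iff_continuousAt]
  intro f
  rw [ContinuousAt, Metric.tendsto_nhds]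
  intro ε hε
  have hp : 0 < ε / 2 * t ^ n := by positivity
  filter_upwards [ev_close ht htR f hp] with g hg
  rw [dist_eq_norm, ← cf_sub hr ht htR]
  have := cf_bound h0 n hg
  refine this.trans_lt ?_
  rw [mul_assoc, ← mul_pow, mul_inv_cancel₀ h0.ne', one_pow]
  linarith

lemma cf_ex_add {r R t : ℝ} (hr : 0 < r) (ht : r < t) (htR : t < R) (f g : C(Ann r R, ℂ)) (n : ℕ) :
    cf t (ex (f + g)) n = cf t (ex f) n + cf t (ex g) n := by
  rw [← cf_add (hr.trans ht) n ((ex_continuousOn f).mono (sphere_sub ht htR))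
    ((ex_continuousOn g).mono (sphere_sub ht htR))]
  apply cf_congr (hr.trans ht).le
  intro z hz
  have hz := sphere_sub ht htR hz
  simp only [ex_of_mem _ hz, ContinuousMap.add_apply]

lemma cf_ex_smul {r R t : ℝ} (hr : 0 < r) (ht : r < t) (htR : t < R) (c : ℂ) (f : C(Ann r R, ℂ))
    (n : ℕ) : cf t (ex (c • f)) n = c * cf t (ex f) n := by
  rw [← cf_smul]
  apply cf_congr (hr.trans ht).le
  intro z hz
  have hz := sphere_sub ht htR hz
  simp only [ex_of_mem _ hz, ContinuousMap.smul_apply, smul_eq_mul]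

lemma cf_ex_zero {r R t : ℝ} (hr : 0 < r) (ht : r < t) (htR : t < R) (n : ℕ) :
    cf t (ex (0 : C(Ann r R, ℂ))) n = 0 := by
  have := cf_ex_add hr ht htR (0 : C(Ann r R, ℂ)) 0 n
  rw [add_zero] at this
  exact left_eq_add.1 this

lemma cf_S {r R t : ℝ} (hr : 0 < r) (ht : r < t) (htR : t < R) (a : ℕ → ℂ) (N n : ℕ) :
    cf t (ex (S r R a N)) n = if n < N then a n else 0 := by
  induction N with
  | zero =>
    have : S r R a 0 = 0 := by ext z; simp [S]
    rw [this, cf_ex_zero hr ht htR]; simp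
  | succ N ih =>
    have h1 : cf t (ex (S r R a (N+1))) n
        = cf t (fun z => ex (S r R a N) z + a N * z ^ (N:ℤ)) n := by
      apply cf_congr (hr.trans ht).le
      intro z hz
      have hz := sphere_sub ht htR hz
      simp [ex_of_mem _ hz, S, Finset.sum_range_succ]
    rw [h1, cf_add (hr.trans ht) n ((ex_continuousOn _).mono (sphere_sub ht htR))
      (by simp only [zpow_natCast]; fun_prop), cf_smul, cf_zpow (hr.trans ht), ih]
    rcases lt_trichotomy n N with h | h | h
    · rw [if_pos h, if_neg (by omega), if_pos (by omega)]; simp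
    · subst h; simp
    · rw [if_neg (by omega), if_neg (by omega), if_neg (by omega)]; simp

lemma cf_T {r R t : ℝ} (hr : 0 < r) (ht : r < t) (htR : t < R) {a : ℕ → ℂ} (ha : Gr r R a) (n : ℕ) :
    cf t (ex (T r R a)) n = a n := by
  have h := ((cf_continuous hr ht htR n).tendsto _).comp (T_tendsto hr (ht.trans htR) ha)
  refine tendsto_nhds_unique h (tendsto_const_nhds.congr' ?_)
  filter_upwards [eventually_gt_atTop n] with N hN
  simp [cf_S hr ht htR, hN]

lemma P_continuousOn {r R t : ℝ} (hr : 0 < r) (ht : r < t) (htR : t < R) :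
    ContinuousOn (fun f : C(Ann r R, ℂ) => T r R (cf t (ex f))) (Hol (Ann r R)) := by
  have hrR := ht.trans htR
  intro f hf
  rw [ContinuousWithinAt, ContinuousMap.tendsto_iff_forall_isCompact_tendstoUniformlyOn]
  intro K hK
  rw [Metric.tendstoUniformlyOn_iff]
  intro ε hε
  obtain ⟨u, h1, h2, h3⟩ := compact_bound hrR hK
  obtain ⟨s, hs1, hs2⟩ := exists_between h2
  have hrs := h1.trans hs1
  have hu0 : 0 < u := hr.trans h1
  have hs0 : 0 < s := hr.trans hrs
  have hq : 0 < 1 - u / s := by rw [sub_pos, div_lt_one hs0]; exact hs1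
  have hp : 0 < ε / 2 * (1 - u / s) := by positivity
  filter_upwards [self_mem_nhdsWithin, mem_nhdsWithin_of_mem_nhds (ev_close hrs hs2 f hp)]
    with g hg hgf z hz
  have gf := gr_hol hr ht htR hf
  have gg := gr_hol hr ht htR hg
  have sm : ∀ {a : ℕ → ℂ}, Gr r R a → Summable fun n => a n * (z:ℂ) ^ n := by
    intro a ha
    obtain ⟨M, hM⟩ := ha s hrs hs2
    exact Summable.of_norm_bounded (summ M hu0 hs1) fun n => term_bound hs0 (h3 z hz) (hM n)
  rw [dist_comm, dist_eq_norm, T_apply hr hrR gf, T_apply hr hrR gg, ← (sm gg).tsum_sub (sm gf)]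
  have hb : ∀ n, ‖cf t (ex g) n * (z:ℂ) ^ n - cf t (ex f) n * (z:ℂ) ^ n‖
      ≤ (ε / 2 * (1 - u / s)) * (u / s) ^ n := by
    intro n
    rw [← sub_mul, cf_indep' hr hrs hs2 ht htR (ex_diff hg), cf_indep' hr hrs hs2 ht htR (ex_diff hf),
      ← cf_sub hr hrs hs2]
    exact term_bound hs0 (h3 z hz) (cf_bound hs0 n hgf)
  have hsum := (hasSum_geometric_of_lt_one (r := u / s) (by positivity) (by linarith)).mul_left
    (ε / 2 * (1 - u / s))
  refine (tsum_of_norm_bounded hsum hb).trans_lt ?_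
  rw [mul_assoc, mul_inv_cancel₀ hq.ne']
  linarith

/-- Functions holomorphic on the disc of radius `R` are fixed by the projection. -/
lemma P_fix {r R t : ℝ} (hr : 0 < r) (ht : r < t) (htR : t < R) {F : ℂ → ℂ}
    (hF : DifferentiableOn ℂ F (ball 0 R)) {f : C(Ann r R, ℂ)} (hf : ∀ z : Ann r R, f z = F z) :
    f ∈ Hol (Ann r R) ∧ T r R (cf t (ex f)) = f := by
  have hsub : Ann r R ⊆ ball 0 R := fun z hz => by simpa using hz.2
  have hol : f ∈ Hol (Ann r R) := ⟨F, hF.mono hsub, hf⟩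
  refine ⟨hol, ?_⟩
  ext z
  rw [T_apply hr (ht.trans htR) (gr_hol hr ht htR hol)]
  obtain ⟨s, hs1, hs2⟩ := exists_between z.2.2
  have hrs := z.2.1.trans hs1
  have hs0 := hr.trans hrs
  have hps := DifferentiableOn.hasFPowerSeriesOnBall (c := 0) (R := NNReal.mk s hs0.le)
    (hF.mono (closedBall_subset_ball hs2)) hs0
  have hz : (z:ℂ) ∈ Metric.eball (0:ℂ) (NNReal.mk s hs0.le : ENNReal) := by
    rw [Metric.eball_coe]
    simpa using hs1
  have hsum := hps.hasSum hz
  rw [zero_add] at hsum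
  rw [hf z, ← hsum.tsum_eq]
  congr 1
  ext n
  rw [cauchyPowerSeries_apply, cf_indep' hr hrs hs2 ht htR (ex_diff hol), mul_comm, ← cf_smul, cf]
  congr 1
  apply circleIntegral.integral_congr hs0.le
  intro w hw
  have hw' := sphere_sub hrs hs2 hw
  simp only [ex_of_mem f hw', hf, sub_zero, smul_eq_mul, div_eq_mul_inv, mul_pow]
  ring

lemma Hol_closed (r R : ℝ) : IsClosed (Hol (Ann r R)) := by
  have : LocallyCompactSpace (Ann r R) := (isOpen_Ann r R).locallyCompactSpace
  rw [← closure_subset_iff_isClosed]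
  intro f hf
  have hne := mem_closure_iff_nhdsWithin_neBot.1 hf
  apply hol_of_diff
  have h : Tendsto id (𝓝[Hol (Ann r R)] f) (𝓝 f) := tendsto_id.mono_left nhdsWithin_le_nhds
  rw [ContinuousMap.tendsto_iff_tendstoLocallyUniformly] at h
  have h2 : TendstoLocallyUniformlyOn (fun g : C(Ann r R, ℂ) => ex g) (ex f)
      (𝓝[Hol (Ann r R)] f) (Ann r R) := by
    rw [tendstoLocallyUniformlyOn_iff_tendstoLocallyUniformly_comp_coe]
    convert h using 1
    · ext g z; exact ex_coe g z
    · ext z; exact ex_coe f z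
  exact h2.differentiableOn (eventually_mem_nhdsWithin.mono fun g hg => ex_diff hg) (isOpen_Ann r R)

end QS

/-- For `0 < r < R < 1` the pair `(A(r,R), Δ)` is quasi-split: the image of restriction
`O(Δ) → O(A(r,R))` is neither dense nor closed, and `O(A(r,R))` is the topological
direct sum of the closure of `O(Δ)|_{A(r,R)}` and some closed subspace `Q_r`. -/
theorem stmt_9 (r R : ℝ) (hr : 0 < r) (hrR : r < R) (hR : R < 1) :
    let Δ : Set ℂ := {z | ‖z‖ < 1}
    let A : Set ℂ := {z | r < ‖z‖ ∧ ‖z‖ < R}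
    let hAΔ : A ⊆ Δ := fun _ hz => lt_trans hz.2 hR
    let res : C(Δ, ℂ) → C(A, ℂ) := fun f =>
      f.comp ⟨Set.inclusion hAΔ, continuous_inclusion hAΔ⟩
    ¬ (Hol A ⊆ closure (res '' Hol Δ)) ∧
    ¬ IsClosed (res '' Hol Δ) ∧
    ∃ Qr : Submodule ℂ C(A, ℂ), IsClosed (Qr : Set C(A, ℂ)) ∧
      ∃ P₁ P₂ : C(A, ℂ) → C(A, ℂ),
        ContinuousOn P₁ (Hol A) ∧ ContinuousOn P₂ (Hol A) ∧
        ∀ f ∈ Hol A, P₁ f ∈ closure (res '' Hol Δ) ∧ P₂ f ∈ (Qr : Set C(A, ℂ)) ∧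
          f = P₁ f + P₂ f ∧
          ∀ g h : C(A, ℂ), g ∈ closure (res '' Hol Δ) → h ∈ (Qr : Set C(A, ℂ)) →
            f = g + h → g = P₁ f ∧ h = P₂ f := by
  intro Δ A hAΔ res
  obtain ⟨t, ht, htR⟩ := exists_between hrR
  have h0t := hr.trans ht
  have hfix : ∀ g ∈ res '' Hol Δ, g ∈ Hol A ∧ QS.T r R (QS.cf t (QS.ex g)) = g := by
    rintro _ ⟨f, ⟨F, hF, hf⟩, rfl⟩
    refine QS.P_fix hr ht htR (F := F) (hF.mono fun z hz => ?_) fun z => hf _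
    rw [mem_ball_zero_iff] at hz
    exact hz.trans hR
  have hcl : closure (res '' Hol Δ) ⊆ Hol A :=
    closure_minimal (fun g hg => (hfix g hg).1) (QS.Hol_closed r R)
  have hfixc : ∀ g ∈ closure (res '' Hol Δ), QS.T r R (QS.cf t (QS.ex g)) = g := by
    intro g hg
    have hne := mem_closure_iff_nhdsWithin_neBot.1 hg
    have hc := (QS.P_continuousOn hr ht htR g (hcl hg)).mono
      (fun g hg => (hfix g hg).1 : res '' Hol Δ ⊆ Hol A)
    refine tendsto_nhds_unique hc.tendsto
      ((tendsto_id.mono_left nhdsWithin_le_nhds).congr' ?_)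
    filter_upwards [self_mem_nhdsWithin] with g hg
    exact (hfix g hg).2.symm
  have hT : ∀ a : ℕ → ℂ, QS.Gr r R a → QS.T r R a ∈ closure (res '' Hol Δ) := by
    intro a ha
    refine mem_closure_of_tendsto (QS.T_tendsto hr hrR ha) (Eventually.of_forall fun N => ?_)
    refine ⟨⟨fun z => ∑ n ∈ Finset.range N, a n * (z:ℂ) ^ n, by fun_prop⟩,
      ⟨fun z => ∑ n ∈ Finset.range N, a n * z ^ n, by fun_prop, fun z => rfl⟩, ?_⟩
    ext z
    rfl
  have hmid : ∀ s : ℝ, r < s → s < R → (s : ℂ) ∈ A := by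
    intro s h1 h2
    have : ‖(s:ℂ)‖ = s := by rw [Complex.norm_real, Real.norm_of_nonneg (hr.trans h1).le]
    exact ⟨by rw [this]; exact h1, by rw [this]; exact h2⟩
  have hne0 : ∀ z : A, (z:ℂ) ≠ 0 := fun z h => by
    have := z.2.1
    rw [h, norm_zero] at this
    linarith
  refine ⟨?_, ?_, ?_⟩
  · intro hd
    let q : C(A, ℂ) := ⟨fun z => (z:ℂ)⁻¹, continuous_subtype_val.inv₀ hne0⟩
    have hq : q ∈ Hol A := ⟨fun z => z⁻¹, differentiableOn_inv.mono fun z hz => hne0 ⟨z, hz⟩,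
      fun z => rfl⟩
    have h1 := hfixc q (hd hq)
    have h2 : QS.cf t (QS.ex q) = 0 := by
      ext n
      rw [QS.cf_congr h0t.le (G := fun z => z ^ (-1 : ℤ)) n, QS.cf_zpow h0t, if_neg (by omega)]
      · rfl
      · intro z hz
        rw [QS.ex_of_mem q (QS.sphere_sub ht htR hz), zpow_neg_one]
        rfl
    have h3 := congrArg (fun f : C(A, ℂ) => f ⟨t, hmid t ht htR⟩) h1
    have h4 := QS.T_apply hr hrR (QS.gr_hol hr ht htR hq) ⟨t, hmid t ht htR⟩
    simp only [h2, Pi.zero_apply, zero_mul, tsum_zero] at h3 h4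
    rw [h4] at h3
    exact inv_ne_zero (hne0 ⟨t, hmid t ht htR⟩) h3.symm
  · intro hc
    have hneR : ∀ z ∈ ball (0:ℂ) R, z - R ≠ 0 := by
      intro z hz h
      rw [mem_ball_zero_iff, sub_eq_zero.1 h, Complex.norm_real,
        Real.norm_of_nonneg (hr.trans hrR).le] at hz
      exact lt_irrefl _ hz
    have hAb : A ⊆ ball 0 R := fun z hz => by simpa using hz.2
    let q : C(A, ℂ) := ⟨fun z => ((z:ℂ) - R)⁻¹,
      (continuous_subtype_val.sub continuous_const).inv₀ fun z => hneR z (hAb z.2)⟩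
    have hq := QS.P_fix hr ht htR (F := fun z => (z - R)⁻¹) (f := q)
      (DifferentiableOn.inv (by fun_prop) hneR) (fun z => rfl)
    have hqc : q ∈ res '' Hol Δ := by
      rw [← hc.closure_eq, ← hq.2]
      exact hT _ (QS.gr_hol hr ht htR hq.1)
    obtain ⟨f, ⟨F, hF, hf⟩, hfq⟩ := hqc
    have hRΔ : (R:ℂ) ∈ Δ := by
      change ‖(R:ℂ)‖ < 1
      rwa [Complex.norm_real, Real.norm_of_nonneg (hr.trans hrR).le]
    have hΔo : IsOpen Δ := isOpen_lt continuous_norm continuous_const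
    have hFc : ContinuousAt F (R:ℂ) := (hF.differentiableAt (hΔo.mem_nhds hRΔ)).continuousAt
    have hval : ∀ s : ℝ, r < s → s < R → F s * ((s:ℂ) - R) = 1 := by
      intro s h1 h2
      have hs := hmid s h1 h2
      have e1 := congrArg (fun f : C(A, ℂ) => f ⟨s, hs⟩) hfq
      have e2 : f ⟨s, hAΔ hs⟩ = ((s:ℂ) - R)⁻¹ := e1
      rw [hf] at e2
      change F s = _ at e2
      rw [e2, inv_mul_cancel₀ (hneR s (hAb hs))]
    have hl : Tendsto (fun s : ℝ => F s * ((s:ℂ) - R)) (𝓝[<] R) (𝓝 (F R * ((R:ℂ) - R))) := by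
      have hco : Tendsto (fun s : ℝ => (s:ℂ)) (𝓝[<] R) (𝓝 (R:ℂ)) :=
        (Complex.continuous_ofReal.tendsto R).mono_left nhdsWithin_le_nhds
      exact (hFc.tendsto.comp hco).mul (hco.sub tendsto_const_nhds)
    have hl1 : Tendsto (fun s : ℝ => F s * ((s:ℂ) - R)) (𝓝[<] R) (𝓝 1) := by
      refine tendsto_const_nhds.congr' ?_
      filter_upwards [Ioo_mem_nhdsLT hrR] with s hs
      exact (hval s hs.1 hs.2).symm
    have := tendsto_nhds_unique hl hl1
    simp at this
  · let Q : Submodule ℂ C(A, ℂ) :=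
      { carrier := {h | ∀ n, QS.cf t (QS.ex h) n = 0}
        add_mem' := fun {a b} ha hb n => by
          rw [QS.cf_ex_add hr ht htR, ha n, hb n, add_zero]
        zero_mem' := fun n => QS.cf_ex_zero hr ht htR n
        smul_mem' := fun c f hf n => by rw [QS.cf_ex_smul hr ht htR, hf n, mul_zero] }
    refine ⟨Q, ?_, fun f => QS.T r R (QS.cf t (QS.ex f)),
      fun f => f - QS.T r R (QS.cf t (QS.ex f)), QS.P_continuousOn hr ht htR,
      continuousOn_id.sub (QS.P_continuousOn hr ht htR), ?_⟩
    · have : (Q : Set C(A, ℂ)) = ⋂ n, {h | QS.cf t (QS.ex h) n = 0} := by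
        ext h
        simp only [mem_iInter]
        rfl
      rw [this]
      exact isClosed_iInter fun n => isClosed_eq (QS.cf_continuous hr ht htR n) continuous_const
    · intro f hf
      have hg := QS.gr_hol hr ht htR hf
      refine ⟨hT _ hg, ?_, by simp, ?_⟩
      · intro n
        have := QS.cf_ex_add hr ht htR (f - QS.T r R (QS.cf t (QS.ex f)))
          (QS.T r R (QS.cf t (QS.ex f))) n
        rw [sub_add_cancel, QS.cf_T hr ht htR hg] at this
        simpa using this
      · intro g h hgc hh hfg
        have e : QS.cf t (QS.ex f) = QS.cf t (QS.ex g) := by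
          ext n
          rw [hfg, QS.cf_ex_add hr ht htR, hh n, add_zero]
        have e2 : g = QS.T r R (QS.cf t (QS.ex f)) := by rw [e, hfixc g hgc]
        refine ⟨e2, ?_⟩
        change h = f - QS.T r R (QS.cf t (QS.ex f))
        rw [← e2, hfg, add_sub_cancel_left]
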